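/- Let p be a prime number and let k be a perfect field of characteristic p. Then the ring W(k) ⊗_ℤ ℚ is a field. -/

import Mathlib

open scoped TensorProduct

theorem WittVector.charZero_of_charP
    (p : ℕ) [Fact p.Prime] (k : Type*) [Field k] [CharP k p] :
    CharZero (WittVector p k) := by
  refine charZero_of_inj_zero fun n hn => ?_
  by_contra h0
  obtain ⟨m, r, hr, rfl⟩ := Nat.exists_eq_pow_mul_and_not_dvd h0 p (Fact.out : p.Prime).ne_one
  rw [Nat.cast_mul, Nat.cast_pow, mul_eq_zero] at hn
  rcases hn with h | h
  · exact WittVector.p_nonzero p k (eq_zero_of_pow_eq_zero h)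
  · apply hr
    rw [← CharP.cast_eq_zero_iff k p r, ← map_natCast (WittVector.constantCoeff (p := p)), h,
      map_zero]

/-- For a prime `p` and a perfect field `k` of characteristic `p`, the ring
`W(k) ⊗[ℤ] ℚ` is a field. -/
theorem witt_tensor_rat_isField
    (p : ℕ) [Fact p.Prime] (k : Type*) [Field k] [CharP k p] [PerfectRing k p] :
    IsField (WittVector p k ⊗[ℤ] ℚ) := by
  have := WittVector.charZero_of_charP p k
  let M := Algebra.algebraMapSubmonoid (WittVector p k) (nonZeroDivisors ℤ)
  have hloc : IsLocalization M (WittVector p k ⊗[ℤ] ℚ) :=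
    IsLocalization.tensor ℚ (nonZeroDivisors ℤ)
  have hM : M ≤ nonZeroDivisors (WittVector p k) :=
    map_le_nonZeroDivisors_of_injective _ (algebraMap ℤ (WittVector p k)).injective_int le_rfl
  have hinj := IsLocalization.injective (WittVector p k ⊗[ℤ] ℚ) hM
  have := hinj.nontrivial
  have hp : IsUnit (algebraMap (WittVector p k) (WittVector p k ⊗[ℤ] ℚ) p) :=
    IsLocalization.map_units _ (⟨(p : WittVector p k), (p : ℤ),
      mem_nonZeroDivisors_of_ne_zero (by exact_mod_cast (Fact.out : p.Prime).ne_zero),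
      by simp⟩ : M)
  refine ⟨exists_pair_ne _, mul_comm, fun {a} ha => ?_⟩
  apply IsUnit.exists_right_inv
  obtain ⟨x, s, rfl⟩ := IsLocalization.exists_mk'_eq M a
  obtain ⟨m, u, rfl⟩ := WittVector.exists_eq_pow_p_mul' x (by rintro rfl; simp at ha)
  rw [← (IsLocalization.map_units (WittVector p k ⊗[ℤ] ℚ) s).mul_left_iff,
    IsLocalization.mk'_spec', map_mul, map_pow]
  exact (hp.pow m).mul (u.isUnit.map _)
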